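/- For every ν ∈ {0, 1, …, 12} and every v ∈ ℂ^6, one has 13^2 · G0(S·T^ν·v) = −13·G0(v) + Σ_{j=1}^{12} ζ^{jν} G_j(v). -/

import Mathlib

open Complex Finset

noncomputable section

/-- `ζ = exp(2πi/13)`. -/
def zeta13 : ℂ := Complex.exp (2 * Real.pi * Complex.I / 13)

local notation "ζ" => zeta13

/-- The diagonal matrix `T = diag(ζ^7, ζ^11, ζ^8, ζ^6, ζ^2, ζ^5)`. -/
def Tmat : Matrix (Fin 6) (Fin 6) ℂ :=
  Matrix.diagonal ![ζ ^ 7, ζ ^ 11, ζ ^ 8, ζ ^ 6, ζ ^ 2, ζ ^ 5]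

/-- The matrix `S = -(1/√13)·M`. -/
def Smat : Matrix (Fin 6) (Fin 6) ℂ :=
  (-(1 / (Real.sqrt 13 : ℂ))) • Matrix.of
    ![![ζ^12 - ζ, ζ^10 - ζ^3, ζ^4 - ζ^9, ζ^5 - ζ^8, ζ^2 - ζ^11, ζ^6 - ζ^7],
      ![ζ^10 - ζ^3, ζ^4 - ζ^9, ζ^12 - ζ, ζ^2 - ζ^11, ζ^6 - ζ^7, ζ^5 - ζ^8],
      ![ζ^4 - ζ^9, ζ^12 - ζ, ζ^10 - ζ^3, ζ^6 - ζ^7, ζ^5 - ζ^8, ζ^2 - ζ^11],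
      ![ζ^5 - ζ^8, ζ^2 - ζ^11, ζ^6 - ζ^7, ζ - ζ^12, ζ^3 - ζ^10, ζ^9 - ζ^4],
      ![ζ^2 - ζ^11, ζ^6 - ζ^7, ζ^5 - ζ^8, ζ^3 - ζ^10, ζ^9 - ζ^4, ζ - ζ^12],
      ![ζ^6 - ζ^7, ζ^5 - ζ^8, ζ^2 - ζ^11, ζ^9 - ζ^4, ζ - ζ^12, ζ^3 - ζ^10]]

/-- The matrix `H`, mapping `(z1,…,z6)` to `(z6, z4, z5, −z3, −z1, −z2)`. -/
def Hmat : Matrix (Fin 6) (Fin 6) ℂ :=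
  Matrix.of
    ![![0,0,0,0,0,1], ![0,0,0,1,0,0], ![0,0,0,0,1,0],
      ![0,0,-1,0,0,0], ![-1,0,0,0,0,0], ![0,-1,0,0,0,0]]

/-- The senary quadratic forms `A_0, …, A_6` (here `v 0 = z1, …, v 5 = z6`). -/
def A : ℕ → (Fin 6 → ℂ) → ℂ
  | 0, v => v 0 * v 3 + v 1 * v 4 + v 2 * v 5
  | 1, v => v 0 ^ 2 - 2 * v 2 * v 3
  | 2, v => -v 4 ^ 2 - 2 * v 1 * v 3
  | 3, v => v 1 ^ 2 - 2 * v 0 * v 4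
  | 4, v => v 2 ^ 2 - 2 * v 1 * v 5
  | 5, v => -v 3 ^ 2 - 2 * v 0 * v 5
  | 6, v => -v 5 ^ 2 - 2 * v 2 * v 4
  | _, _ => 0

/-- `w_ν = (A0 + ζ^ν A1 + ζ^{4ν} A2 + ζ^{9ν} A3 + ζ^{3ν} A4 + ζ^{12ν} A5 + ζ^{10ν} A6)^2`. -/
def w (ν : ℕ) (v : Fin 6 → ℂ) : ℂ :=
  (A 0 v + ζ ^ ν * A 1 v + ζ ^ (4 * ν) * A 2 v + ζ ^ (9 * ν) * A 3 v +
    ζ ^ (3 * ν) * A 4 v + ζ ^ (12 * ν) * A 5 v + ζ ^ (10 * ν) * A 6 v) ^ 2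

/-- `w_∞ = 13·A0^2`. -/
def winf (v : Fin 6 → ℂ) : ℂ := 13 * A 0 v ^ 2

/-- The senary cubic forms `D_0, …, D_12` (here `v 0 = z1, …, v 5 = z6`). -/
def D : ℕ → (Fin 6 → ℂ) → ℂ
  | 0, v => v 0 * v 1 * v 2
  | 1, v => 2 * v 1 * v 2 ^ 2 + v 1 ^ 2 * v 5 - v 3 ^ 2 * v 4 + v 0 * v 4 * v 5
  | 2, v => -v 5 ^ 3 + v 1 ^ 2 * v 3 - 2 * v 1 * v 4 ^ 2 + v 0 * v 3 * v 4 + 3 * v 2 * v 4 * v 5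
  | 3, v => 2 * v 0 * v 1 ^ 2 + v 0 ^ 2 * v 4 - v 3 * v 5 ^ 2 + v 2 * v 3 * v 4
  | 4, v => -v 1 ^ 2 * v 2 + v 0 * v 5 ^ 2 - 2 * v 3 ^ 2 * v 5 - v 0 * v 2 * v 4
  | 5, v => -v 3 ^ 3 + v 2 ^ 2 * v 4 - 2 * v 2 * v 5 ^ 2 + v 1 * v 4 * v 5 + 3 * v 0 * v 3 * v 5
  | 6, v => -v 4 ^ 3 + v 0 ^ 2 * v 5 - 2 * v 0 * v 3 ^ 2 + v 2 * v 3 * v 5 + 3 * v 1 * v 3 * v 4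
  | 7, v => -v 1 ^ 3 + v 2 * v 3 ^ 2 - v 0 * v 2 * v 5 - 3 * v 0 * v 1 * v 4 + 2 * v 0 ^ 2 * v 3
  | 8, v => -v 0 ^ 3 + v 1 * v 5 ^ 2 - v 1 * v 2 * v 4 - 3 * v 0 * v 2 * v 3 + 2 * v 2 ^ 2 * v 5
  | 9, v => 2 * v 0 ^ 2 * v 2 + v 2 ^ 2 * v 3 - v 4 ^ 2 * v 5 + v 1 * v 3 * v 5
  | 10, v => -v 0 * v 2 ^ 2 + v 1 * v 3 ^ 2 - 2 * v 3 * v 4 ^ 2 - v 0 * v 1 * v 5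
  | 11, v => -v 2 ^ 3 + v 0 * v 4 ^ 2 - v 0 * v 1 * v 3 - 3 * v 1 * v 2 * v 5 + 2 * v 1 ^ 2 * v 4
  | 12, v => -v 0 ^ 2 * v 1 + v 2 * v 4 ^ 2 - 2 * v 4 * v 5 ^ 2 - v 1 * v 2 * v 3
  | _, _ => 0

/-- The senary cubic form `D_∞ = z4 z5 z6`. -/
def Dinf (v : Fin 6 → ℂ) : ℂ := v 3 * v 4 * v 5

/-- The senary sextic forms `G_0, …, G_12`. -/
def Gs : ℕ → (Fin 6 → ℂ) → ℂ
  | 0, v => D 0 v ^ 2 + Dinf v ^ 2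
  | 1, v => -D 7 v ^ 2 + 2 * D 0 v * D 1 v + 10 * Dinf v * D 1 v + 2 * D 2 v * D 12 v
      - 2 * D 3 v * D 11 v - 4 * D 4 v * D 10 v - 2 * D 9 v * D 5 v
  | 2, v => -2 * D 1 v ^ 2 - 4 * D 0 v * D 2 v + 6 * Dinf v * D 2 v - 2 * D 4 v * D 11 v
      + 2 * D 5 v * D 10 v - 2 * D 6 v * D 9 v - 2 * D 7 v * D 8 v
  | 3, v => -D 8 v ^ 2 + 2 * D 0 v * D 3 v + 10 * Dinf v * D 3 v + 2 * D 6 v * D 10 v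
      - 2 * D 9 v * D 7 v - 4 * D 12 v * D 4 v - 2 * D 1 v * D 2 v
  | 4, v => -D 2 v ^ 2 + 10 * D 0 v * D 4 v - 2 * Dinf v * D 4 v + 2 * D 5 v * D 12 v
      - 2 * D 9 v * D 8 v - 4 * D 1 v * D 3 v - 2 * D 10 v * D 7 v
  | 5, v => -2 * D 9 v ^ 2 - 4 * D 0 v * D 5 v + 6 * Dinf v * D 5 v - 2 * D 10 v * D 8 v
      + 2 * D 6 v * D 12 v - 2 * D 2 v * D 3 v - 2 * D 11 v * D 7 v
  | 6, v => -2 * D 3 v ^ 2 - 4 * D 0 v * D 6 v + 6 * Dinf v * D 6 v - 2 * D 12 v * D 7 v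
      + 2 * D 2 v * D 4 v - 2 * D 5 v * D 1 v - 2 * D 8 v * D 11 v
  | 7, v => -2 * D 10 v ^ 2 + 6 * D 0 v * D 7 v + 4 * Dinf v * D 7 v - 2 * D 1 v * D 6 v
      - 2 * D 2 v * D 5 v - 2 * D 8 v * D 12 v - 2 * D 9 v * D 11 v
  | 8, v => -2 * D 4 v ^ 2 + 6 * D 0 v * D 8 v + 4 * Dinf v * D 8 v - 2 * D 3 v * D 5 v
      - 2 * D 6 v * D 2 v - 2 * D 11 v * D 10 v - 2 * D 1 v * D 7 v
  | 9, v => -D 11 v ^ 2 + 2 * D 0 v * D 9 v + 10 * Dinf v * D 9 v + 2 * D 5 v * D 4 v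
      - 2 * D 1 v * D 8 v - 4 * D 10 v * D 12 v - 2 * D 3 v * D 6 v
  | 10, v => -D 5 v ^ 2 + 10 * D 0 v * D 10 v - 2 * Dinf v * D 10 v + 2 * D 6 v * D 4 v
      - 2 * D 3 v * D 7 v - 4 * D 9 v * D 1 v - 2 * D 12 v * D 11 v
  | 11, v => -2 * D 12 v ^ 2 + 6 * D 0 v * D 11 v + 4 * Dinf v * D 11 v - 2 * D 9 v * D 2 v
      - 2 * D 5 v * D 6 v - 2 * D 7 v * D 4 v - 2 * D 3 v * D 8 v
  | 12, v => -D 6 v ^ 2 + 10 * D 0 v * D 12 v - 2 * Dinf v * D 12 v + 2 * D 2 v * D 10 v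
      - 2 * D 1 v * D 11 v - 4 * D 3 v * D 9 v - 2 * D 4 v * D 8 v
  | _, _ => 0

/-- `δ_ν = −13·G0 + Σ_{j=1}^{12} ζ^{jν} G_j`. -/
def deltaF (ν : ℕ) (v : Fin 6 → ℂ) : ℂ :=
  -13 * Gs 0 v + ∑ j ∈ Finset.Icc 1 12, ζ ^ (j * ν) * Gs j v

/-- `δ_∞ = 13^2·G0`. -/
def deltaInf (v : Fin 6 → ℂ) : ℂ := 13 ^ 2 * Gs 0 v

/-- `Φ4 = Σ_ν w_ν + w_∞`. -/
def Phi4 (v : Fin 6 → ℂ) : ℂ := (∑ ν ∈ Finset.range 13, w ν v) + winf v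

/-- `Φ8 = Σ_ν w_ν^2 + w_∞^2`. -/
def Phi8 (v : Fin 6 → ℂ) : ℂ := (∑ ν ∈ Finset.range 13, w ν v ^ 2) + winf v ^ 2

/-- `Φ12′ = −(1/(13·30))(Σ_ν w_ν^3 + w_∞^3)`. -/
def Phi12' (v : Fin 6 → ℂ) : ℂ :=
  -(1 / (13 * 30)) * ((∑ ν ∈ Finset.range 13, w ν v ^ 3) + winf v ^ 3)

/-- `Φ16 = Σ_ν w_ν^4 + w_∞^4`. -/
def Phi16 (v : Fin 6 → ℂ) : ℂ := (∑ ν ∈ Finset.range 13, w ν v ^ 4) + winf v ^ 4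

/-- `Φ20 = (1/(13·25))(Σ_ν w_ν^5 + w_∞^5)`. -/
def Phi20 (v : Fin 6 → ℂ) : ℂ :=
  (1 / (13 * 25)) * ((∑ ν ∈ Finset.range 13, w ν v ^ 5) + winf v ^ 5)

/-- `Φ12 = −(1/(13·52))(Σ_ν δ_ν^2 + δ_∞^2)`. -/
def Phi12 (v : Fin 6 → ℂ) : ℂ :=
  -(1 / (13 * 52)) * ((∑ ν ∈ Finset.range 13, deltaF ν v ^ 2) + deltaInf v ^ 2)

/-- `Φ18 = (1/(13·6))(Σ_ν δ_ν^3 + δ_∞^3)`. -/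
def Phi18 (v : Fin 6 → ℂ) : ℂ :=
  (1 / (13 * 6)) * ((∑ ν ∈ Finset.range 13, deltaF ν v ^ 3) + deltaInf v ^ 3)

/-- `Φ30 = −(1/(13·1315))(Σ_ν δ_ν^5 + δ_∞^5)`. -/
def Phi30 (v : Fin 6 → ℂ) : ℂ :=
  -(1 / (13 * 1315)) * ((∑ ν ∈ Finset.range 13, deltaF ν v ^ 5) + deltaInf v ^ 5)

/-- `q^α = exp(2πiαz)`. -/
def qp (α : ℚ) (z : ℂ) : ℂ := Complex.exp (2 * Real.pi * Complex.I * (α : ℂ) * z)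

/-- `Σ_{n∈ℤ} (−1)^n q^{(13n^2+cn)/2}`. -/
def thetaSum (c : ℤ) (z : ℂ) : ℂ :=
  ∑' n : ℤ, (-1 : ℂ) ^ n * qp ((13 * (n : ℚ) ^ 2 + (c : ℚ) * (n : ℚ)) / 2) z

/-- The theta constants of order 13: `a_1, …, a_6`. -/
def thc : ℕ → ℂ → ℂ
  | 1, z => qp (121 / 104) z * thetaSum 11 z
  | 2, z => qp (49 / 104) z * thetaSum 7 z
  | 3, z => qp (25 / 104) z * thetaSum 5 z
  | 4, z => -(qp (9 / 104) z * thetaSum 3 z)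
  | 5, z => qp (81 / 104) z * thetaSum 9 z
  | 6, z => qp (1 / 104) z * thetaSum 1 z
  | _, _ => 0

/-- The vector `A(z) = (a1(z), …, a6(z))`. -/
def Avec (z : ℂ) : Fin 6 → ℂ := fun i => thc (i.val + 1) z

/-- The Dedekind eta function `η(z) = q^{1/24} Π_{n=1}^∞ (1−q^n)`. -/
def etaF (z : ℂ) : ℂ :=
  qp (1 / 24) z * ∏' n : ℕ, (1 - Complex.exp (2 * Real.pi * Complex.I * z) ^ (n + 1))

/-- The vector `(x1(z), …, x6(z))` with `x_i(z) = η(z)·a_i(z)`. -/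
def X (z : ℂ) : Fin 6 → ℂ := fun i => etaF z * thc (i.val + 1) z

/-- The discriminant `Δ(z) = η(z)^24`. -/
def Delta (z : ℂ) : ℂ := etaF z ^ 24

/-- The Eisenstein series `E4(z) = (1/2) Σ_{gcd(m,n)=1} (mz+n)^{−4}`. -/
def E4 (z : ℂ) : ℂ :=
  (1 / 2) * ∑' p : {p : ℤ × ℤ // Int.gcd p.1 p.2 = 1},
    ((p.1.1 : ℂ) * z + (p.1.2 : ℂ)) ^ (-4 : ℤ)

/-- The Eisenstein series `E6(z) = (1/2) Σ_{gcd(m,n)=1} (mz+n)^{−6}`. -/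
def E6 (z : ℂ) : ℂ :=
  (1 / 2) * ∑' p : {p : ℤ × ℤ // Int.gcd p.1 p.2 = 1},
    ((p.1.1 : ℂ) * z + (p.1.2 : ℂ)) ^ (-6 : ℤ)

/-- Cyclotomic identities between the elements `x ^ j - x ^ (-j)` and the Gaussian periods attached
to a root `x` of the thirteenth cyclotomic polynomial. -/
theorem cubic_eq_periods {R : Type*} [CommRing R] {x : R} (hx : ∑ i ∈ range 13, x ^ i = 0)
    {a b c d e f p q t : R} (ha : a = x ^ 12 - x) (hb : b = x ^ 10 - x ^ 3)
    (hc : c = x ^ 4 - x ^ 9) (hd : d = x ^ 5 - x ^ 8) (he : e = x ^ 2 - x ^ 11)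
    (hf : f = x ^ 6 - x ^ 7) (hp : p = x + x ^ 3 + x ^ 9) (hq : q = x ^ 2 + x ^ 5 + x ^ 6)
    (ht : t = x ^ 7 + x ^ 8 + x ^ 11) :
    a * b * c = -q + t ∧
    a ^ 2 * b + a * c ^ 2 + b ^ 2 * c = 1 + 2 * p + 2 * t ∧
    a ^ 2 * c + a * b ^ 2 + b * c ^ 2 = 2 + 4 * p + 4 * q ∧
    a * b * f + a * c * e + b * c * d = 2 * q - 2 * t ∧
    a * b * d + a * c * f + b * c * e = 1 + 2 * p + 2 * q ∧
    a * b * e + a * c * d + b * c * f = 1 + 2 * p + q + t ∧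
    a ^ 3 + 3 * a * b * c + b ^ 3 + c ^ 3 = 2 + 4 * p - q + 5 * t ∧
    a ^ 2 * e + a * b * d + a * c * f + b ^ 2 * f + b * c * e + c ^ 2 * d = -q + t ∧
    a ^ 2 * f + a * b * e + a * c * d + b ^ 2 * d + b * c * f + c ^ 2 * e = -3 * q + 3 * t ∧
    a ^ 2 * d + a * b * f + a * c * e + b ^ 2 * e + b * c * d + c ^ 2 * f = 1 + 2 * p + 2 * t ∧
    a * e * f + b * d * f + c * d * e = -2 - 4 * p - 2 * q - 2 * t ∧
    a * d * e + a * f ^ 2 + b * d ^ 2 + b * e * f + c * d * f + c * e ^ 2 = 1 + 2 * p + q + t ∧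
    a * d * f + a * e ^ 2 + b * d * e + b * f ^ 2 + c * d ^ 2 + c * e * f =
      3 + 6 * p + 3 * q + 3 * t ∧
    a * d * f + b * d * e + c * e * f = q - t ∧
    a * d ^ 2 + a * e * f + b * d * f + b * e ^ 2 + c * d * e + c * f ^ 2 = 1 + 2 * p + 2 * q ∧
    a * d * e + b * e * f + c * d * f = -1 - 2 * p - 2 * t ∧
    d * e * f = -1 - 2 * p - q - t ∧
    d ^ 2 * e + d * f ^ 2 + e ^ 2 * f = -1 - 2 * p - 2 * q ∧
    d ^ 2 * f + d * e ^ 2 + e * f ^ 2 = 2 + 4 * p + 4 * t ∧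
    d ^ 3 + 3 * d * e * f + e ^ 3 + f ^ 3 = -3 - 6 * p - 5 * q - t := by
  simp only [sum_range_succ, sum_range_zero] at hx
  subst ha hb hc hd he hf hp hq ht
  and_intros <;> grind

/-- The multiplication table of the four Gaussian periods of degree three attached to a root `x` of
the thirteenth cyclotomic polynomial. -/
theorem period_mul_table {R : Type*} [CommRing R] {x : R} (hx : ∑ i ∈ range 13, x ^ i = 0)
    {p q s t : R} (hp : p = x + x ^ 3 + x ^ 9) (hq : q = x ^ 2 + x ^ 5 + x ^ 6)
    (hs : s = x ^ 4 + x ^ 10 + x ^ 12) (ht : t = x ^ 7 + x ^ 8 + x ^ 11) :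
    p + q + s + t = -1 ∧
    p ^ 2 = q + 2 * s ∧ q ^ 2 = s + 2 * t ∧ s ^ 2 = t + 2 * p ∧ t ^ 2 = p + 2 * q ∧
    p * q = p + q + t ∧ q * s = p + q + s ∧ p * t = p + s + t ∧
    p * s = 3 + q + t ∧ q * t = 3 + p + s := by
  simp only [sum_range_succ, sum_range_zero] at hx
  subst hp hq hs ht
  and_intros <;> grind

/-- The product of the three linear forms given by the first three rows of `-√13 • Smat`, with an
arbitrary primitive thirteenth root of unity `x` in place of `ζ`, lies in the span of the cubic
forms. -/
theorem prod_rows_eq {x : ℂ} (hx : ∑ i ∈ range 13, x ^ i = 0) (z : Fin 6 → ℂ)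
    {a b c d e f p q t : ℂ} (ha : a = x ^ 12 - x) (hb : b = x ^ 10 - x ^ 3)
    (hc : c = x ^ 4 - x ^ 9) (hd : d = x ^ 5 - x ^ 8) (he : e = x ^ 2 - x ^ 11)
    (hf : f = x ^ 6 - x ^ 7) (hp : p = x + x ^ 3 + x ^ 9) (hq : q = x ^ 2 + x ^ 5 + x ^ 6)
    (ht : t = x ^ 7 + x ^ 8 + x ^ 11) :
    (a * z 0 + b * z 1 + c * z 2 + d * z 3 + e * z 4 + f * z 5) *
      (b * z 0 + c * z 1 + a * z 2 + e * z 3 + f * z 4 + d * z 5) *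
      (c * z 0 + a * z 1 + b * z 2 + f * z 3 + d * z 4 + e * z 5) =
    (2 + 4 * p - q + 5 * t) * D 0 z +
      (1 + 2 * p + 2 * q) * (D 1 z + D 3 z + D 9 z) +
      (1 + 2 * p + q + t) * (D 2 z + D 5 z + D 6 z) +
      (-1 - 2 * p - 2 * t) * (D 4 z + D 10 z + D 12 z) +
      (q - t) * (D 7 z + D 8 z + D 11 z) +
      (-3 - 6 * p - 5 * q - t) * Dinf z := by
  obtain ⟨h000, h001, h002, h003, h004, h005, h012, h013, h014, h015, h033, h034, h035, h044,
    h045, h055, h333, h334, h335, h345⟩ :=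
    cubic_eq_periods hx ha hb hc hd he hf hp hq ht
  simp only [D, Dinf]
  linear_combination (z 0 ^ 3 + z 1 ^ 3 + z 2 ^ 3) * h000 +
      (z 0 ^ 2 * z 1 + z 1 ^ 2 * z 2 + z 0 * z 2 ^ 2) * h001 +
      (z 0 ^ 2 * z 2 + z 0 * z 1 ^ 2 + z 1 * z 2 ^ 2) * h002 +
      (z 0 ^ 2 * z 3 + z 1 ^ 2 * z 4 + z 2 ^ 2 * z 5) * h003 +
      (z 0 ^ 2 * z 4 + z 1 ^ 2 * z 5 + z 2 ^ 2 * z 3) * h004 +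
      (z 0 ^ 2 * z 5 + z 1 ^ 2 * z 3 + z 2 ^ 2 * z 4) * h005 +
      z 0 * z 1 * z 2 * h012 +
      (z 0 * z 1 * z 3 + z 1 * z 2 * z 4 + z 0 * z 2 * z 5) * h013 +
      (z 0 * z 1 * z 4 + z 1 * z 2 * z 5 + z 0 * z 2 * z 3) * h014 +
      (z 0 * z 1 * z 5 + z 1 * z 2 * z 3 + z 0 * z 2 * z 4) * h015 +
      (z 0 * z 3 ^ 2 + z 1 * z 4 ^ 2 + z 2 * z 5 ^ 2) * h033 +
      (z 0 * z 3 * z 4 + z 1 * z 4 * z 5 + z 2 * z 3 * z 5) * h034 +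
      (z 0 * z 3 * z 5 + z 1 * z 3 * z 4 + z 2 * z 4 * z 5) * h035 +
      (z 0 * z 4 ^ 2 + z 1 * z 5 ^ 2 + z 2 * z 3 ^ 2) * h044 +
      (z 0 * z 4 * z 5 + z 1 * z 3 * z 5 + z 2 * z 3 * z 4) * h045 +
      (z 0 * z 5 ^ 2 + z 1 * z 3 ^ 2 + z 2 * z 4 ^ 2) * h055 +
      (z 3 ^ 3 + z 4 ^ 3 + z 5 ^ 3) * h333 +
      (z 3 ^ 2 * z 4 + z 4 ^ 2 * z 5 + z 3 * z 5 ^ 2) * h334 +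
      (z 3 ^ 2 * z 5 + z 3 * z 4 ^ 2 + z 4 * z 5 ^ 2) * h335 +
      z 3 * z 4 * z 5 * h345

/-- The sum of a square and its conjugate under the cyclic shift `p ↦ q ↦ s ↦ t ↦ p` of the Gaussian
periods, for the linear form with the coefficients of `prod_rows_eq`. -/
theorem sq_add_sq_eq_of_periods {R : Type*} [CommRing R] {p q s t : R}
    (hsum : p + q + s + t = -1) (hpp : p ^ 2 = q + 2 * s) (hqq : q ^ 2 = s + 2 * t)
    (hss : s ^ 2 = t + 2 * p) (htt : t ^ 2 = p + 2 * q) (hpq : p * q = p + q + t)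
    (hqs : q * s = p + q + s) (hpt : p * t = p + s + t) (hps : p * s = 3 + q + t)
    (hqt : q * t = 3 + p + s) (d d' u v w y : R) :
    ((2 + 4 * p - q + 5 * t) * d + (1 + 2 * p + 2 * q) * u + (1 + 2 * p + q + t) * v +
      (-1 - 2 * p - 2 * t) * w + (q - t) * y + (-3 - 6 * p - 5 * q - t) * d') ^ 2 +
    ((2 + 4 * q - s + 5 * p) * d + (1 + 2 * q + 2 * s) * u + (1 + 2 * q + s + p) * v +
      (-1 - 2 * q - 2 * p) * w + (s - p) * y + (-3 - 6 * q - 5 * s - p) * d') ^ 2 =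
    13 * (-13 * d ^ 2 + 2 * d * u - 4 * d * v + 10 * d * w + 6 * d * y - 2 * u ^ 2 - 2 * u * v -
      2 * u * y + 10 * u * d' - v ^ 2 + 2 * v * w + 6 * v * d' - 2 * w ^ 2 - 2 * w * y -
      2 * w * d' - y ^ 2 + 4 * y * d' - 13 * d' ^ 2) := by
  obtain ⟨α, hα⟩ : ∃ α, α = 2 * d + u + v - w - 3 * d' := ⟨_, rfl⟩
  obtain ⟨β, hβ⟩ : ∃ β, β = 4 * d + 2 * u + 2 * v - 2 * w - 6 * d' := ⟨_, rfl⟩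
  obtain ⟨γ, hγ⟩ : ∃ γ, γ = -d + 2 * u + v + y - 5 * d' := ⟨_, rfl⟩
  obtain ⟨ε, hε⟩ : ∃ ε, ε = 5 * d + v - 2 * w - y - d' := ⟨_, rfl⟩
  have expand : (α + β * p + γ * q + ε * t) ^ 2 + (α + β * q + γ * s + ε * p) ^ 2 =
      2 * α ^ 2 + 12 * γ * ε +
        (2 * α * β + 2 * α * ε + 2 * γ ^ 2 + ε ^ 2 + 4 * β * γ + 4 * β * ε + 2 * γ * ε) * p +
        (2 * α * β + 2 * α * γ + β ^ 2 + 3 * ε ^ 2 + 4 * β * γ + 2 * β * ε + 2 * γ * ε) * q +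
        (2 * α * γ + 3 * β ^ 2 + γ ^ 2 + 2 * ε ^ 2 + 2 * β * γ + 2 * β * ε + 2 * γ * ε) * s +
        (2 * α * ε + 2 * β ^ 2 + 3 * γ ^ 2 + 2 * β * γ + 4 * β * ε + 2 * γ * ε) * t := by
    linear_combination (β ^ 2 + ε ^ 2) * hpp + (β ^ 2 + γ ^ 2) * hqq + γ ^ 2 * hss + ε ^ 2 * htt +
      2 * β * (γ + ε) * hpq + 2 * β * ε * hpt + 2 * γ * ε * hqt + 2 * β * γ * hqs + 2 * γ * ε * hps
  subst hα hβ hγ hε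
  linear_combination expand + (2 * (2 * d + u + v - w - 3 * d') * (5 * d + v - 2 * w - y - d') +
    2 * (4 * d + 2 * u + 2 * v - 2 * w - 6 * d') ^ 2 + 3 * (-d + 2 * u + v + y - 5 * d') ^ 2 +
    2 * (4 * d + 2 * u + 2 * v - 2 * w - 6 * d') * (-d + 2 * u + v + y - 5 * d') +
    4 * (4 * d + 2 * u + 2 * v - 2 * w - 6 * d') * (5 * d + v - 2 * w - y - d') +
    2 * (-d + 2 * u + v + y - 5 * d') * (5 * d + v - 2 * w - y - d')) * hsum

/-- The sum of the squares of the linear combination in `prod_rows_eq` and of its conjugate is a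
quadratic form with rational coefficients in the cubic forms. -/
theorem sq_add_sq_eq_sum_Gs {p q s t : ℂ}
    (hsum : p + q + s + t = -1) (hpp : p ^ 2 = q + 2 * s) (hqq : q ^ 2 = s + 2 * t)
    (hss : s ^ 2 = t + 2 * p) (htt : t ^ 2 = p + 2 * q) (hpq : p * q = p + q + t)
    (hqs : q * s = p + q + s) (hpt : p * t = p + s + t) (hps : p * s = 3 + q + t)
    (hqt : q * t = 3 + p + s) (z : Fin 6 → ℂ) :
    ((2 + 4 * p - q + 5 * t) * D 0 z +
      (1 + 2 * p + 2 * q) * (D 1 z + D 3 z + D 9 z) +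
      (1 + 2 * p + q + t) * (D 2 z + D 5 z + D 6 z) +
      (-1 - 2 * p - 2 * t) * (D 4 z + D 10 z + D 12 z) +
      (q - t) * (D 7 z + D 8 z + D 11 z) +
      (-3 - 6 * p - 5 * q - t) * Dinf z) ^ 2 +
    ((2 + 4 * q - s + 5 * p) * D 0 z +
      (1 + 2 * q + 2 * s) * (D 1 z + D 3 z + D 9 z) +
      (1 + 2 * q + s + p) * (D 2 z + D 5 z + D 6 z) +
      (-1 - 2 * q - 2 * p) * (D 4 z + D 10 z + D 12 z) +
      (s - p) * (D 7 z + D 8 z + D 11 z) +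
      (-3 - 6 * q - 5 * s - p) * Dinf z) ^ 2 =
    13 * (-13 * Gs 0 z + ∑ j ∈ Icc 1 12, Gs j z) := by
  rw [sq_add_sq_eq_of_periods hsum hpp hqq hss htt hpq hqs hpt hps hqt]
  simp only [sum_Icc_succ_top (Nat.le_add_left 1 _), Icc_self, sum_singleton, Nat.reduceAdd, Gs]
  ring

/-- `D j` is an eigenvector of weight `j` for the torus element `diag(y^7, y^11, y^8, y^6, y^2, y^5)`
with `y ^ 13 = 1`, and `Dinf` is invariant. -/
theorem D_torus {y : ℂ} (hy : y ^ 13 = 1) {u v : Fin 6 → ℂ} (h0 : u 0 = y ^ 7 * v 0)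
    (h1 : u 1 = y ^ 11 * v 1) (h2 : u 2 = y ^ 8 * v 2) (h3 : u 3 = y ^ 6 * v 3)
    (h4 : u 4 = y ^ 2 * v 4) (h5 : u 5 = y ^ 5 * v 5) :
    Dinf u = Dinf v ∧ ∀ j < 13, D j u = y ^ j * D j v := by
  refine ⟨by simp only [Dinf, h3, h4, h5]; grind, fun j hj => ?_⟩
  interval_cases j <;> simp only [D, h0, h1, h2, h3, h4, h5] <;> grind

/-- `Gs j` is an eigenvector of weight `j` for the torus element
`diag(y^7, y^11, y^8, y^6, y^2, y^5)` with `y ^ 13 = 1`. -/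
theorem Gs_torus {y : ℂ} (hy : y ^ 13 = 1) {u v : Fin 6 → ℂ} (h0 : u 0 = y ^ 7 * v 0)
    (h1 : u 1 = y ^ 11 * v 1) (h2 : u 2 = y ^ 8 * v 2) (h3 : u 3 = y ^ 6 * v 3)
    (h4 : u 4 = y ^ 2 * v 4) (h5 : u 5 = y ^ 5 * v 5) {j : ℕ} (hj : j < 13) :
    Gs j u = y ^ j * Gs j v := by
  obtain ⟨hinf, hD⟩ := D_torus hy h0 h1 h2 h3 h4 h5
  interval_cases j <;> simp only [Gs, hinf, hD, Nat.reduceLT] <;> grind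

theorem zeta13_isPrimitiveRoot : IsPrimitiveRoot ζ 13 :=
  Complex.isPrimitiveRoot_exp 13 (by norm_num)

/-- The sum of the squares of the products of the first three and of the last three rows of
`-√13 • Smat`, with an arbitrary primitive thirteenth root of unity `x` in place of `ζ`. -/
theorem prod_rows_sq_add_sq {x : ℂ} (hx : IsPrimitiveRoot x 13) (z : Fin 6 → ℂ) :
    (((x ^ 12 - x) * z 0 + (x ^ 10 - x ^ 3) * z 1 + (x ^ 4 - x ^ 9) * z 2 + (x ^ 5 - x ^ 8) * z 3
        + (x ^ 2 - x ^ 11) * z 4 + (x ^ 6 - x ^ 7) * z 5) *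
      ((x ^ 10 - x ^ 3) * z 0 + (x ^ 4 - x ^ 9) * z 1 + (x ^ 12 - x) * z 2 + (x ^ 2 - x ^ 11) * z 3
        + (x ^ 6 - x ^ 7) * z 4 + (x ^ 5 - x ^ 8) * z 5) *
      ((x ^ 4 - x ^ 9) * z 0 + (x ^ 12 - x) * z 1 + (x ^ 10 - x ^ 3) * z 2 + (x ^ 6 - x ^ 7) * z 3
        + (x ^ 5 - x ^ 8) * z 4 + (x ^ 2 - x ^ 11) * z 5)) ^ 2 +
    (((x ^ 5 - x ^ 8) * z 0 + (x ^ 2 - x ^ 11) * z 1 + (x ^ 6 - x ^ 7) * z 2 + (x - x ^ 12) * z 3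
        + (x ^ 3 - x ^ 10) * z 4 + (x ^ 9 - x ^ 4) * z 5) *
      ((x ^ 2 - x ^ 11) * z 0 + (x ^ 6 - x ^ 7) * z 1 + (x ^ 5 - x ^ 8) * z 2 +
        (x ^ 3 - x ^ 10) * z 3 + (x ^ 9 - x ^ 4) * z 4 + (x - x ^ 12) * z 5) *
      ((x ^ 6 - x ^ 7) * z 0 + (x ^ 5 - x ^ 8) * z 1 + (x ^ 2 - x ^ 11) * z 2 +
        (x ^ 9 - x ^ 4) * z 3 + (x - x ^ 12) * z 4 + (x ^ 3 - x ^ 10) * z 5)) ^ 2 =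
    13 * (-13 * Gs 0 z + ∑ j ∈ Icc 1 12, Gs j z) := by
  have h13 : x ^ 13 = 1 := hx.pow_eq_one
  have hgeom := hx.geom_sum_eq_zero (by norm_num)
  have hgeom' := (hx.pow_of_coprime 5 (by norm_num)).geom_sum_eq_zero (by norm_num)
  have hconj := prod_rows_eq hgeom' z (a := x ^ 8 - x ^ 5) (b := x ^ 11 - x ^ 2)
    (c := x ^ 7 - x ^ 6) (d := x ^ 12 - x) (e := x ^ 10 - x ^ 3) (f := x ^ 4 - x ^ 9)
    (p := x ^ 2 + x ^ 5 + x ^ 6) (q := x ^ 4 + x ^ 10 + x ^ 12) (t := x + x ^ 3 + x ^ 9)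
    (by grind) (by grind) (by grind) (by grind) (by grind) (by grind) (by grind) (by grind)
    (by grind)
  obtain ⟨hsum, hpp, hqq, hss, htt, hpq, hqs, hpt, hps, hqt⟩ :=
    period_mul_table hgeom rfl rfl rfl rfl
  rw [← sq_add_sq_eq_sum_Gs hsum hpp hqq hss htt hpq hqs hpt hps hqt z, ← hconj,
    prod_rows_eq hgeom z rfl rfl rfl rfl rfl rfl rfl rfl rfl]
  have neg_prod_sq {k l m k' l' m' : ℂ} (hk : k' = -k) (hl : l' = -l) (hm : m' = -m) :
      (k' * l' * m') ^ 2 = (k * l * m) ^ 2 := by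
    rw [hk, hl, hm]
    ring
  exact congrArg _ (neg_prod_sq (by ring) (by ring) (by ring))

/-- The transformation formula of `Gs 0` under `Smat`. -/
theorem Gs_zero_Smat_mulVec (v : Fin 6 → ℂ) :
    (13 : ℂ) ^ 2 * Gs 0 (Smat.mulVec v) = -13 * Gs 0 v + ∑ j ∈ Icc 1 12, Gs j v := by
  have key := prod_rows_sq_add_sq zeta13_isPrimitiveRoot v
  have hsqrt : (1 / (Real.sqrt 13 : ℂ)) ^ 6 = 1 / 13 ^ 3 := by
    rw [show 6 = 2 * 3 from rfl, pow_mul, div_pow _ _ 2, ← Complex.ofReal_pow,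
      Real.sq_sqrt (by norm_num)]
    norm_num
  have hG : Gs 0 (Smat.mulVec v) =
      D 0 (Smat.mulVec v) ^ 2 + Dinf (Smat.mulVec v) ^ 2 := rfl
  rw [hG]
  simp only [D, Dinf, Smat, Matrix.smul_mulVec, Pi.smul_apply, smul_eq_mul]
  simp only [Matrix.mulVec, dotProduct, Fin.sum_univ_six, Matrix.of_apply, Matrix.cons_val]
  generalize (1 / (Real.sqrt 13 : ℂ)) = r at hsqrt ⊢
  generalize -13 * Gs 0 v + ∑ j ∈ Icc 1 12, Gs j v = g at key ⊢
  refine .trans ?_ (show 13 ^ 2 * (r ^ 6 * (13 * g)) = g by rw [hsqrt]; ring)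
  rw [← key]
  have scale (a b c d e f : ℂ) : 13 ^ 2 * ((-r * a * (-r * b) * (-r * c)) ^ 2 +
      (-r * d * (-r * e) * (-r * f)) ^ 2) =
      13 ^ 2 * (r ^ 6 * ((a * b * c) ^ 2 + (d * e * f) ^ 2)) := by ring
  exact scale _ _ _ _ _ _

/-- `13² · G0(S·T^ν·v) = −13·G0(v) + Σ_{j=1}^{12} ζ^{jν} G_j(v)` for `0 ≤ ν ≤ 12`. -/
theorem stmt_4 (ν : ℕ) (hν : ν ≤ 12) (v : Fin 6 → ℂ) :
    (13 : ℂ) ^ 2 * Gs 0 ((Smat * Tmat ^ ν).mulVec v) =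
      -13 * Gs 0 v + ∑ j ∈ Finset.Icc 1 12, ζ ^ (j * ν) * Gs j v := by
  have hy : (ζ ^ ν) ^ 13 = 1 := by
    rw [pow_right_comm, zeta13_isPrimitiveRoot.pow_eq_one, one_pow]
  have hT : ∀ {j}, j < 13 → Gs j ((Tmat ^ ν).mulVec v) = (ζ ^ ν) ^ j * Gs j v := by
    apply Gs_torus hy <;>
      simp [Tmat, Matrix.diagonal_pow, Matrix.mulVec_diagonal, pow_right_comm _ _ ν]
  rw [← Matrix.mulVec_mulVec, Gs_zero_Smat_mulVec, hT (by simp), pow_zero, one_mul]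
  congr 1
  refine sum_congr rfl fun j hj => ?_
  rw [mem_Icc] at hj
  rw [hT (by omega), ← pow_mul, mul_comm ν]

end
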